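/- arXiv:2412.16862 — 2 statements merged into one kernel-verified Lean document; each statement's English description precedes it below -/
import Mathlib

section
/- Define, for real a, c, ψ₁(a,c) = 8(−a + c + a² + 4ac + c² − 2a²c − 2c³). Let 0 ≤ c ≤ a ≤ 1/2 satisfy ψ₁(a,c) ≥ 0, and set w = (3/2 − (3−2c)(1+2c)/(2(3−2a)), 1−c) ∈ ℝ². Then |w − q_U| = |w − q_D| = |w − q_R|, and for every F among UL, L, LD, UR, RD one has |w − q_F| ≥ |w − q_U|, where q_U = (a, 3−c), q_D = (a, −1−c), q_UL = (−1+c, 2+a), q_L = (−1−a, c), q_LD = (−1−c, −a), q_UR = (2−c, 3−a), q_R = (3−a, c), q_RD = (2+c, −1+a). -/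
/-- The point (x, y) of the Euclidean plane. -/
noncomputable def pt2 (x y : ℝ) : EuclideanSpace ℝ (Fin 2) :=
  (WithLp.equiv 2 (Fin 2 → ℝ)).symm ![x, y]

/-- ψ₁(a,c) = 8(−a + c + a² + 4ac + c² − 2a²c − 2c³). -/
noncomputable def psi1 (a c : ℝ) : ℝ :=
  8 * (-a + c + a ^ 2 + 4 * a * c + c ^ 2 - 2 * a ^ 2 * c - 2 * c ^ 3)

/-- The distance between two points of the plane, in coordinates. -/
lemma dist_pt2 (x y u v : ℝ) :
    dist (pt2 x y) (pt2 u v) = √((x - u) ^ 2 + (y - v) ^ 2) := by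
  simp [pt2, EuclideanSpace.dist_eq, Real.dist_eq, sq_abs]

/-- Empty-circle property of the triangle (q_U, q_D, q_R) when ψ₁(a,c) ≥ 0,
with circumcenter w = (3/2 − (3−2c)(1+2c)/(2(3−2a)), 1−c). -/
theorem UDR_Delaunay (a c : ℝ) (hc : 0 ≤ c) (hca : c ≤ a) (ha : a ≤ 1 / 2)
    (hpsi : 0 ≤ psi1 a c) :
    dist (pt2 (3 / 2 - (3 - 2 * c) * (1 + 2 * c) / (2 * (3 - 2 * a))) (1 - c))
          (pt2 a (3 - c)) =
        dist (pt2 (3 / 2 - (3 - 2 * c) * (1 + 2 * c) / (2 * (3 - 2 * a))) (1 - c))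
          (pt2 a (-1 - c)) ∧
      dist (pt2 (3 / 2 - (3 - 2 * c) * (1 + 2 * c) / (2 * (3 - 2 * a))) (1 - c))
          (pt2 a (-1 - c)) =
        dist (pt2 (3 / 2 - (3 - 2 * c) * (1 + 2 * c) / (2 * (3 - 2 * a))) (1 - c))
          (pt2 (3 - a) c) ∧
      (∀ q ∈ ({pt2 (-1 + c) (2 + a), pt2 (-1 - a) c, pt2 (-1 - c) (-a),
          pt2 (2 - c) (3 - a), pt2 (2 + c) (-1 + a)} :
          Set (EuclideanSpace ℝ (Fin 2))),
        dist (pt2 (3 / 2 - (3 - 2 * c) * (1 + 2 * c) / (2 * (3 - 2 * a))) (1 - c))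
            (pt2 a (3 - c)) ≤
          dist (pt2 (3 / 2 - (3 - 2 * c) * (1 + 2 * c) / (2 * (3 - 2 * a))) (1 - c))
            q) := by
  have hD : 0 < 3 - 2 * a := by linarith
  have hP : 0 ≤ -a + c + a ^ 2 + 4 * a * c + c ^ 2 - 2 * a ^ 2 * c - 2 * c ^ 3 := by
    unfold psi1 at hpsi
    linarith
  have hX : (3 / 2 - (3 - 2 * c) * (1 + 2 * c) / (2 * (3 - 2 * a))) * (2 * (3 - 2 * a)) =
      3 * (3 - 2 * a) - (3 - 2 * c) * (1 + 2 * c) := by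
    field_simp
  generalize 3 / 2 - (3 - 2 * c) * (1 + 2 * c) / (2 * (3 - 2 * a)) = X at hX ⊢
  have hL : 0 ≤ (a - c) * (1 - a - c) := mul_nonneg (by linarith) (by linarith)
  simp only [dist_pt2]
  refine ⟨by congr 1; ring, by congr 1; linear_combination hX, ?_⟩
  simp only [Set.mem_insert_iff, Set.mem_singleton_iff]
  rintro q (rfl | rfl | rfl | rfl | rfl) <;> rw [dist_pt2] <;> apply Real.sqrt_le_sqrt <;>
    refine le_of_mul_le_mul_right ?_ hD
  · have h₁ : 0 ≤ c ^ 2 * (1 - c) := mul_nonneg (sq_nonneg c) (by linarith)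
    have h₂ : 0 ≤ a * c * (2 - a) :=
      mul_nonneg (mul_nonneg (by linarith) hc) (by linarith)
    linear_combination 10 * hL + 4 * h₁ + 4 * h₂ - (1 + a - c) * hX
  · linear_combination 16 * hL - (1 + 2 * a) * hX
  · have h : 0 ≤ c * ((1 - a) * (3 - a) - c + c ^ 2) :=
      mul_nonneg hc (by nlinarith)
    linear_combination 10 * hL + 4 * h - (1 + a + c) * hX
  · have h : 0 ≤ c * ((1 - 2 * a) * (5 - 2 * a) + (1 - 2 * c) ^ 2) :=
      mul_nonneg hc (add_nonneg (mul_nonneg (by linarith) (by linarith)) (sq_nonneg _))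
    linear_combination 2 * hP + 2 * h - (a + c - 2) * hX
  · linear_combination 2 * hP - (a - c - 2) * hX
end

section
/- For all real a, b, c with 0 ≤ c ≤ b ≤ a ≤ 1/2, the point w = (1 − (a+c)(1−c)/(2−a+c), 1 − (b + 2c(1−c))/(3−2b), 1−c) in ℝ³ is equidistant from the four points p_U = (a, b, 3−c), p_B = (a, 3−b, c), p_D = (a, b, −1−c), p_RD = (2+c, b, −1+a). -/
/-- The point (x, y, z) of Euclidean 3-space. -/
noncomputable def pt3 (x y z : ℝ) : EuclideanSpace ℝ (Fin 3) :=
  (WithLp.equiv 2 (Fin 3 → ℝ)).symm ![x, y, z]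

/-- A point `w` is equidistant from four points. -/
def Equidist4 (w p q r s : EuclideanSpace ℝ (Fin 3)) : Prop :=
  dist w p = dist w q ∧ dist w q = dist w r ∧ dist w r = dist w s

theorem dist_pt3 (x y z x' y' z' : ℝ) :
    dist (pt3 x y z) (pt3 x' y' z') =
      Real.sqrt ((x - x') ^ 2 + (y - y') ^ 2 + (z - z') ^ 2) := by
  simp [pt3, EuclideanSpace.dist_eq, Fin.sum_univ_three, Real.dist_eq, sq_abs]

/-- The circumcenter c(B,D,RD) of the tetrahedron (p_U, p_B, p_D, p_RD). -/
theorem circumcenter_B_D_RD (a b c : ℝ) (hc : 0 ≤ c) (hcb : c ≤ b) (hba : b ≤ a)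
    (ha : a ≤ 1 / 2) :
    Equidist4
      (pt3 (1 - (a + c) * (1 - c) / (2 - a + c))
        (1 - (b + 2 * c * (1 - c)) / (3 - 2 * b)) (1 - c))
      (pt3 a b (3 - c)) (pt3 a (3 - b) c) (pt3 a b (-1 - c))
      (pt3 (2 + c) b (-1 + a)) := by
  have h₁ : 2 - a + c ≠ 0 := by
    apply ne_of_gt
    linarith
  have h₂ : 3 - 2 * b ≠ 0 := by
    apply ne_of_gt
    linarith
  simp only [Equidist4, dist_pt3]
  refine ⟨congrArg Real.sqrt ?_, congrArg Real.sqrt ?_, congrArg Real.sqrt ?_⟩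
  all_goals
    field_simp
    ring
end
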